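/- Let n ≥ 1 and let k > 0 be an even integer. If f : H⁺ → Cl_n is smooth and k-hypermonogenic, i.e. Df + k(Qf)′/x_n = 0 on H⁺, then Δf is (k−2)-hypermonogenic on H⁺, i.e. D(Δf) + (k−2)(Q(Δf))′/x_n = 0 on H⁺. -/

import Mathlib

noncomputable section

open scoped symmDiff

/-- An explicit model of the real Clifford algebra `Cl_n` with generators `e 0, …, e (n-1)`
satisfying `eᵢ eⱼ + eⱼ eᵢ = -2 δᵢⱼ` (the Clifford algebra of the negative definite
quadratic form on `ℝⁿ`): elements are coordinate functions on the canonical basis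
`(e_A)_{A ⊆ {0,…,n-1}}`, where `e_A` is the (increasingly ordered) product of the `e i`, `i ∈ A`. -/
def Cl (n : ℕ) : Type := Finset (Fin n) → ℝ

namespace Cl

variable {n : ℕ}

instance : NormedAddCommGroup (Cl n) :=
  inferInstanceAs (NormedAddCommGroup (Finset (Fin n) → ℝ))

instance : NormedSpace ℝ (Cl n) :=
  inferInstanceAs (NormedSpace ℝ (Finset (Fin n) → ℝ))

/-- The coefficient of `a` at the basis element `e_A`. -/
def coeff (a : Cl n) (A : Finset (Fin n)) : ℝ := a A

/-- The sign occurring in the product `e_A * e_B = mulSign A B • e_{A ∆ B}`,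
coming from the relations `eᵢ eⱼ = -eⱼ eᵢ` (i ≠ j) and `eᵢ² = -1`. -/
def mulSign (A B : Finset (Fin n)) : ℝ :=
  (-1 : ℝ) ^ (((A ×ˢ B).filter fun p => p.2 < p.1).card + (A ∩ B).card)

/-- Clifford multiplication. -/
def mul (a b : Cl n) : Cl n := fun C =>
  ∑ A : Finset (Fin n), ∑ B : Finset (Fin n),
    if A ∆ B = C then mulSign A B * a A * b B else 0

/-- The unit `1` of the Clifford algebra. -/
def one : Cl n := Pi.single ∅ 1

/-- The embedding of the real scalars. -/
def scalar (r : ℝ) : Cl n := Pi.single ∅ r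

/-- The generators `e i` (in the paper: `e_1, …, e_n`). -/
def e (i : Fin n) : Cl n := Pi.single {i} 1

/-- Reversion: the anti-automorphism fixing all the `e i`. -/
def reverse (a : Cl n) : Cl n := fun A => (-1 : ℝ) ^ (A.card * (A.card - 1) / 2) * a A

/-- The main involution `′`: the automorphism with `(e i)′ = - e i`. -/
def involute (a : Cl n) : Cl n := fun A => (-1 : ℝ) ^ A.card * a A

/-- Clifford conjugation: the anti-automorphism with `conj (e i) = - e i`
(the composite of reversion and the main involution). -/
def conj (a : Cl n) : Cl n := fun A => (-1 : ℝ) ^ (A.card * (A.card + 1) / 2) * a A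

/-- The norm on `Cl n`: the square root of the sum of the squares of the
coordinates in the standard basis. -/
def norm (a : Cl n) : ℝ := Real.sqrt (∑ A : Finset (Fin n), a A ^ 2)

/-- Invertibility in the Clifford algebra. -/
def IsInvertible (a : Cl n) : Prop := ∃ b, mul a b = one ∧ mul b a = one

/-- The inverse of an invertible Clifford number (junk value `0` otherwise). -/
def inv (a : Cl n) : Cl n :=
  letI := Classical.propDecidable (IsInvertible a)
  if h : IsInvertible a then h.choose else 0

/-- The paravector `x₀ + x₁ e₁ + ⋯ + xₙ eₙ` attached to `x ∈ ℝ^{n+1}`. -/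
def para (x : Fin (n + 1) → ℝ) : Cl n :=
  scalar (x 0) + ∑ i : Fin n, x i.succ • e i

/-- Being a paravector. -/
def IsParavector (a : Cl n) : Prop := ∃ x : Fin (n + 1) → ℝ, a = para x

/-- The coordinates in `ℝ^{n+1}` of (the paravector part of) a Clifford number. -/
def paraCoord (a : Cl n) : Fin (n + 1) → ℝ :=
  Fin.cases (coeff a ∅) (fun i => coeff a {i})

/-- Being a (possibly empty) product of nonzero paravectors. -/
def IsProdOfParavectors (a : Cl n) : Prop :=
  ∃ l : List (Fin (n + 1) → ℝ), (∀ x ∈ l, x ≠ 0) ∧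
    a = l.foldr (fun x b => mul (para x) b) one

/-- The special Ahlfors–Vahlen group `SAV(ℝ ⊕ ℝⁿ)`: 2×2 matrices `(a b; c d)` with entries
in `Cl n` such that each entry is `0` or a product of nonzero paravectors,
`a ⬝ reverse d - b ⬝ reverse c = 1`, and `a c⁻¹, c⁻¹ d` are paravectors if `c ≠ 0`
resp. `b d⁻¹` is a paravector if `c = 0`. -/
structure SAV (n : ℕ) where
  a : Cl n
  b : Cl n
  c : Cl n
  d : Cl n
  prod_a : a = 0 ∨ IsProdOfParavectors a
  prod_b : b = 0 ∨ IsProdOfParavectors b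
  prod_c : c = 0 ∨ IsProdOfParavectors c
  prod_d : d = 0 ∨ IsProdOfParavectors d
  det : mul a (reverse d) - mul b (reverse c) = one
  cond_c : c ≠ 0 → IsParavector (mul a (inv c)) ∧ IsParavector (mul (inv c) d)
  cond_c0 : c = 0 → IsParavector (mul b (inv d))

/-- The Clifford number `c x + d` attached to a matrix `M` and `x ∈ ℝ^{n+1}`. -/
def cxd (M : SAV n) (x : Fin (n + 1) → ℝ) : Cl n := mul M.c (para x) + M.d

/-- The numerator `a x + b`. -/
def axb (M : SAV n) (x : Fin (n + 1) → ℝ) : Cl n := mul M.a (para x) + M.b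

/-- The Möbius transformation `M<x> = (ax+b)(cx+d)⁻¹` as a Clifford number. -/
def moebiusCl (M : SAV n) (x : Fin (n + 1) → ℝ) : Cl n := mul (axb M x) (inv (cxd M x))

/-- The Möbius transformation `M<x>` as a point of `ℝ^{n+1}`. -/
def moebius (M : SAV n) (x : Fin (n + 1) → ℝ) : Fin (n + 1) → ℝ :=
  paraCoord (moebiusCl M x)

/-- `a` lies in the subalgebra `Cl_{n-1}` generated by the `e j` with `j ≠ i`. -/
def memSub (a : Cl n) (i : Fin n) : Prop := ∀ A : Finset (Fin n), i ∈ A → coeff a A = 0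

/-- The subgroup `SAV(ℝ ⊕ ℝ^{m})` of `SAV(ℝ ⊕ ℝ^{m+1})` of matrices whose entries lie
in the subalgebra `Cl_m ⊆ Cl_{m+1}`. -/
structure SAVsub (m : ℕ) extends SAV (m + 1) where
  sub_a : memSub a (Fin.last m)
  sub_b : memSub b (Fin.last m)
  sub_c : memSub c (Fin.last m)
  sub_d : memSub d (Fin.last m)

/-- The `P`-part of `a ∈ Cl_{m+1} = Cl_m ⊕ Cl_m e_{top}`: `a = P a + (Q a) e_top`. -/
def Ppart {m : ℕ} (a : Cl (m + 1)) : Cl (m + 1) := fun A =>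
  if Fin.last m ∈ A then 0 else a A

/-- The `Q`-part of `a ∈ Cl_{m+1} = Cl_m ⊕ Cl_m e_{top}`: `a = P a + (Q a) e_top`. -/
def Qpart {m : ℕ} (a : Cl (m + 1)) : Cl (m + 1) := fun A =>
  if Fin.last m ∈ A then 0 else a (insert (Fin.last m) A)

/-- Partial derivative `∂f/∂xᵢ`. -/
def pderiv {E : Type*} [NormedAddCommGroup E] [NormedSpace ℝ E] {m : ℕ}
    (i : Fin m) (f : (Fin m → ℝ) → E) (x : Fin m → ℝ) : E :=
  fderiv ℝ f x (Pi.single i 1)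

/-- The Euclidean Laplacian `Δ = Σᵢ ∂²/∂xᵢ²` (acting componentwise). -/
def lap {E : Type*} [NormedAddCommGroup E] [NormedSpace ℝ E] {m : ℕ}
    (f : (Fin m → ℝ) → E) : (Fin m → ℝ) → E :=
  fun x => ∑ i : Fin m, pderiv i (pderiv i f) x

/-- The Euclidean Dirac operator `D f = ∂f/∂x₀ + Σᵢ eᵢ ∂f/∂xᵢ`. -/
def dirac (f : (Fin (n + 1) → ℝ) → Cl n) : (Fin (n + 1) → ℝ) → Cl n :=
  fun x => pderiv 0 f x + ∑ i : Fin n, mul (e i) (pderiv i.succ f x)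

/-- Upper half-space `H⁺ = {x ∈ ℝ^{n+1} : xₙ > 0}`. -/
def upperHalf (n : ℕ) : Set (Fin (n + 1) → ℝ) := {x | 0 < x (Fin.last n)}

/-- The Euclidean norm on `ℝ^m`. -/
def enorm {m : ℕ} (x : Fin m → ℝ) : ℝ := Real.sqrt (∑ i, x i ^ 2)

end Cl
namespace Cl

section PartialDerivatives

variable {E F : Type*} [NormedAddCommGroup E] [NormedSpace ℝ E]
  [NormedAddCommGroup F] [NormedSpace ℝ F] {m : ℕ} {U : Set (Fin m → ℝ)}

lemma differentiableAt_of_smoothOn {f : (Fin m → ℝ) → E} (hU : IsOpen U)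
    (hf : ContDiffOn ℝ (⊤ : ℕ∞) f U) {x : Fin m → ℝ} (hx : x ∈ U) : DifferentiableAt ℝ f x :=
  (hf.contDiffAt (hU.mem_nhds hx)).differentiableAt (by simp)

lemma smoothOn_pderiv {f : (Fin m → ℝ) → E} (hU : IsOpen U)
    (hf : ContDiffOn ℝ (⊤ : ℕ∞) f U) (i : Fin m) :
    ContDiffOn ℝ (⊤ : ℕ∞) (pderiv i f) U :=
  (hf.fderiv_of_isOpen hU (m := (⊤ : ℕ∞)) (by simp)).clm_apply contDiffOn_const

lemma pderiv_congr {f g : (Fin m → ℝ) → E} (hU : IsOpen U) (h : Set.EqOn f g U) (i : Fin m) :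
    Set.EqOn (pderiv i f) (pderiv i g) U := fun x hx => by
  have : f =ᶠ[nhds x] g := Filter.eventuallyEq_of_mem (hU.mem_nhds hx) h
  simp [pderiv, this.fderiv_eq]

lemma pderiv_clm (L : E →L[ℝ] F) {f : (Fin m → ℝ) → E} {x : Fin m → ℝ}
    (hf : DifferentiableAt ℝ f x) (i : Fin m) :
    pderiv i (fun y => L (f y)) x = L (pderiv i f x) := by
  have : HasFDerivAt (fun y => L (f y)) (L.comp (fderiv ℝ f x)) x :=
    L.hasFDerivAt.comp x hf.hasFDerivAt
  simp [pderiv, this.fderiv]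

lemma pderiv_sum {ι : Type*} (s : Finset ι) {f : ι → (Fin m → ℝ) → E} {x : Fin m → ℝ}
    (hf : ∀ j ∈ s, DifferentiableAt ℝ (f j) x) (i : Fin m) :
    pderiv i (fun y => ∑ j ∈ s, f j y) x = ∑ j ∈ s, pderiv i (f j) x := by
  simp [pderiv, fderiv_fun_sum hf]

lemma pderiv_coord_smul (l : Fin m) {f : (Fin m → ℝ) → E} {x : Fin m → ℝ}
    (hf : DifferentiableAt ℝ f x) (i : Fin m) :
    pderiv i (fun y => y l • f y) x = (if i = l then f x else 0) + x l • pderiv i f x := by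
  have hl : HasFDerivAt (fun y : Fin m → ℝ => y l)
      (ContinuousLinearMap.proj (R := ℝ) (φ := fun _ : Fin m => ℝ) l) x :=
    (ContinuousLinearMap.proj (R := ℝ) (φ := fun _ : Fin m => ℝ) l).hasFDerivAt
  simp only [pderiv, (hl.fun_smul hf.hasFDerivAt).fderiv]
  by_cases h : i = l
  · subst h; simp [add_comm]
  · simp [h, Ne.symm h]

lemma pderiv_comm {f : (Fin m → ℝ) → E} (hU : IsOpen U)
    (hf : ContDiffOn ℝ (⊤ : ℕ∞) f U) {x : Fin m → ℝ} (hx : x ∈ U) (i j : Fin m) :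
    pderiv i (pderiv j f) x = pderiv j (pderiv i f) x := by
  have hd : DifferentiableAt ℝ (fderiv ℝ f) x :=
    differentiableAt_of_smoothOn hU
      (hf.fderiv_of_isOpen hU (m := (⊤ : ℕ∞)) (by simp)) hx
  have key (a b : Fin m) : pderiv a (pderiv b f) x =
      fderiv ℝ (fderiv ℝ f) x (Pi.single a 1) (Pi.single b 1) := by
    have := (hd.hasFDerivAt.clm_apply (hasFDerivAt_const (Pi.single b (1 : ℝ)) x)).fderiv
    unfold pderiv
    rw [this]
    simp
  rw [key, key]
  exact ((hf.contDiffAt (hU.mem_nhds hx)).isSymmSndFDerivAt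
    (by simpa using WithTop.coe_le_coe.2 (le_top : (2 : ℕ∞) ≤ ⊤))) _ _

lemma smoothOn_clm (L : E →L[ℝ] F) {f : (Fin m → ℝ) → E}
    (hf : ContDiffOn ℝ (⊤ : ℕ∞) f U) : ContDiffOn ℝ (⊤ : ℕ∞) (fun y => L (f y)) U :=
  L.contDiff.comp_contDiffOn hf

lemma lap_congr {f g : (Fin m → ℝ) → E} (hU : IsOpen U) (h : Set.EqOn f g U) :
    Set.EqOn (lap f) (lap g) U := fun _ hx =>
  Finset.sum_congr rfl fun i _ => pderiv_congr hU (pderiv_congr hU h i) i hx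

lemma lap_clm (L : E →L[ℝ] F) {f : (Fin m → ℝ) → E} (hU : IsOpen U)
    (hf : ContDiffOn ℝ (⊤ : ℕ∞) f U) {x : Fin m → ℝ} (hx : x ∈ U) :
    lap (fun y => L (f y)) x = L (lap f x) := by
  simp only [lap, map_sum]
  refine Finset.sum_congr rfl fun i _ => ?_
  have h : Set.EqOn (pderiv i fun y => L (f y)) (fun y => L (pderiv i f y)) U := fun y hy =>
    pderiv_clm L (differentiableAt_of_smoothOn hU hf hy) i
  rw [pderiv_congr hU h i hx,
    pderiv_clm L (differentiableAt_of_smoothOn hU (smoothOn_pderiv hU hf i) hx)]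

lemma lap_coord_smul (l : Fin m) {f : (Fin m → ℝ) → E} (hU : IsOpen U)
    (hf : ContDiffOn ℝ (⊤ : ℕ∞) f U) {x : Fin m → ℝ} (hx : x ∈ U) :
    lap (fun y => y l • f y) x = x l • lap f x + (2 : ℝ) • pderiv l f x := by
  have key (i : Fin m) : pderiv i (pderiv i fun y => y l • f y) x =
      x l • pderiv i (pderiv i f) x + if i = l then (2 : ℝ) • pderiv l f x else 0 := by
    have hdi := differentiableAt_of_smoothOn hU (smoothOn_pderiv hU hf i) hx
    have h : Set.EqOn (pderiv i fun y => y l • f y)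
        (fun y => (if i = l then f y else 0) + y l • pderiv i f y) U := fun y hy =>
      pderiv_coord_smul l (differentiableAt_of_smoothOn hU hf hy) i
    rw [pderiv_congr hU h i hx]
    by_cases hi : i = l
    · subst hi
      have h1 : DifferentiableAt ℝ (fun y : Fin m → ℝ => y i • pderiv i f y) x :=
        (differentiableAt_apply i x).fun_smul hdi
      have h2 := pderiv_coord_smul i hdi i
      simp only [if_true] at h2 ⊢
      simp only [pderiv] at h1 h2 ⊢
      rw [fderiv_fun_add (differentiableAt_of_smoothOn hU hf hx) h1,
        add_apply, h2]
      module
    · simpa [hi] using pderiv_coord_smul l hdi i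
  simp [lap, key, Finset.sum_add_distrib, Finset.smul_sum]

/-- A first order operator with constant coefficients commutes with the Laplacian. -/
lemma lap_sum_clm_pderiv (L : Fin m → E →L[ℝ] F) {f : (Fin m → ℝ) → E} (hU : IsOpen U)
    (hf : ContDiffOn ℝ (⊤ : ℕ∞) f U) {x : Fin m → ℝ} (hx : x ∈ U) :
    lap (fun y => ∑ i, L i (pderiv i f y)) x = ∑ i, L i (pderiv i (lap f) x) := by
  have hs := fun i => smoothOn_pderiv hU hf i
  have hss := fun i j => smoothOn_pderiv hU (hs i) j
  have hL := fun i => smoothOn_clm (L i) (hs i)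
  have h1 (j : Fin m) : pderiv j (pderiv j fun y => ∑ i, L i (pderiv i f y)) x =
      ∑ i, L i (pderiv i (pderiv j (pderiv j f)) x) := by
    have h : Set.EqOn (pderiv j fun y => ∑ i, L i (pderiv i f y))
        (fun y => ∑ i, L i (pderiv i (pderiv j f) y)) U := fun y hy => by
      rw [pderiv_sum _ fun i _ => differentiableAt_of_smoothOn hU (hL i) hy]
      refine Finset.sum_congr rfl fun i _ => ?_
      rw [pderiv_clm _ (differentiableAt_of_smoothOn hU (hs i) hy), pderiv_comm hU hf hy]
    rw [pderiv_congr hU h j hx, pderiv_sum _ fun i _ =>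
      differentiableAt_of_smoothOn hU (smoothOn_clm (L i) (hss j i)) hx]
    refine Finset.sum_congr rfl fun i _ => ?_
    rw [pderiv_clm _ (differentiableAt_of_smoothOn hU (hss j i) hx), pderiv_comm hU (hs j) hx]
  have h2 (i : Fin m) : pderiv i (lap f) x = ∑ j, pderiv i (pderiv j (pderiv j f)) x :=
    pderiv_sum _ (fun j _ => differentiableAt_of_smoothOn hU (hss j j) hx) i
  simp only [h2, map_sum]
  rw [Finset.sum_comm]
  exact Finset.sum_congr rfl fun j _ => h1 j

/-- Factorization of the Laplacian into two first order operators whose symbols satisfy the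
Clifford relations. -/
lemma sum_clm_pderiv_sum_clm_pderiv (L : Fin m → E →L[ℝ] F) (M : Fin m → F →L[ℝ] E)
    (hLM : ∀ i j a, M i (L j a) + M j (L i a) = if i = j then (2 : ℝ) • a else 0)
    {f : (Fin m → ℝ) → E} (hU : IsOpen U)
    (hf : ContDiffOn ℝ (⊤ : ℕ∞) f U) {x : Fin m → ℝ} (hx : x ∈ U) :
    ∑ i, M i (pderiv i (fun y => ∑ j, L j (pderiv j f y)) x) = lap f x := by
  have hs := fun i => smoothOn_pderiv hU hf i
  have h1 (i : Fin m) : pderiv i (fun y => ∑ j, L j (pderiv j f y)) x =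
      ∑ j, L j (pderiv i (pderiv j f) x) := by
    rw [pderiv_sum _ fun j _ => differentiableAt_of_smoothOn hU (smoothOn_clm (L j) (hs j)) hx]
    exact Finset.sum_congr rfl fun j _ =>
      pderiv_clm _ (differentiableAt_of_smoothOn hU (hs j) hx) i
  simp only [h1, map_sum]
  set S := ∑ i, ∑ j, M i (L j (pderiv i (pderiv j f) x)) with hS
  have h2 : S = ∑ i, ∑ j, M j (L i (pderiv i (pderiv j f) x)) := by
    rw [hS, Finset.sum_comm]
    exact Finset.sum_congr rfl fun j _ => Finset.sum_congr rfl fun i _ => by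
      rw [pderiv_comm hU hf hx]
  have h3 : S + S = (2 : ℝ) • lap f x := by
    nth_rewrite 2 [h2]
    simp only [hS, ← Finset.sum_add_distrib, hLM]
    simp [lap, Finset.smul_sum]
  rw [← two_smul ℝ S] at h3
  exact smul_right_injective E (two_ne_zero (α := ℝ)) h3

end PartialDerivatives

section Algebra

instance (n : ℕ) : FiniteDimensional ℝ (Cl n) :=
  inferInstanceAs (FiniteDimensional ℝ (Finset (Fin n) → ℝ))

variable {n : ℕ}

lemma add_apply' (a b : Cl n) (C : Finset (Fin n)) : (a + b) C = a C + b C := rfl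

lemma smul_apply' (r : ℝ) (a : Cl n) (C : Finset (Fin n)) : (r • a) C = r * a C := rfl

lemma zero_apply' (C : Finset (Fin n)) : (0 : Cl n) C = 0 := rfl

lemma mul_e_apply (i : Fin n) (a : Cl n) (C : Finset (Fin n)) :
    mul (e i) a C = mulSign {i} ({i} ∆ C) * a ({i} ∆ C) := by
  unfold mul e
  rw [Finset.sum_eq_single {i}, Finset.sum_eq_single ({i} ∆ C)]
  · simp [symmDiff_symmDiff_cancel_left]
  · intro B _ hB
    rw [if_neg]
    rintro rfl
    exact hB (symmDiff_symmDiff_cancel_left _ _).symm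
  · simp
  · intro A _ hA
    simp [Pi.single_eq_of_ne hA]
  · simp

/-- The sign `(-1)^#{j ∈ C | j < i}`. -/
def lowerSign (i : Fin n) (C : Finset (Fin n)) : ℝ := ∏ j ∈ C, if j < i then -1 else 1

lemma mulSign_singleton (i : Fin n) (C : Finset (Fin n)) :
    mulSign {i} C = (if i ∈ C then -1 else 1) * lowerSign i C := by
  have h1 : (({i} ×ˢ C).filter fun p : Fin n × Fin n => p.2 < p.1).card =
      (C.filter fun j => j < i).card := by
    rw [Finset.singleton_product, Finset.filter_map, Finset.card_map]
    rfl
  have h2 : ({i} ∩ C).card = if i ∈ C then 1 else 0 := by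
    split_ifs with h <;> simp [h]
  rw [mulSign, h1, h2, pow_add, lowerSign, Finset.prod_ite]
  split_ifs <;> simp

lemma mem_singleton_symmDiff {i j : Fin n} {C : Finset (Fin n)} :
    j ∈ {i} ∆ C ↔ (j = i ∧ i ∉ C) ∨ (j ≠ i ∧ j ∈ C) := by
  simp only [Finset.mem_symmDiff, Finset.mem_singleton]
  grind

lemma singleton_symmDiff_of_notMem {i : Fin n} {C : Finset (Fin n)} (h : i ∉ C) :
    {i} ∆ C = insert i C := by
  ext j; simp only [mem_singleton_symmDiff, Finset.mem_insert]; grind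

lemma singleton_symmDiff_of_mem {i : Fin n} {C : Finset (Fin n)} (h : i ∈ C) :
    {i} ∆ C = C.erase i := by
  ext j; simp only [mem_singleton_symmDiff, Finset.mem_erase]; grind

lemma lowerSign_symmDiff (i j : Fin n) (C : Finset (Fin n)) :
    lowerSign i ({j} ∆ C) = (if j < i then -1 else 1) * lowerSign i C := by
  unfold lowerSign
  by_cases h : j ∈ C
  · rw [singleton_symmDiff_of_mem h, ← Finset.mul_prod_erase C _ h]
    split_ifs <;> ring
  · rw [singleton_symmDiff_of_notMem h, Finset.prod_insert h]

lemma lowerSign_mul_self (i : Fin n) (C : Finset (Fin n)) :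
    lowerSign i C * lowerSign i C = 1 := by
  unfold lowerSign
  rw [← Finset.prod_mul_distrib]
  exact Finset.prod_eq_one fun j _ => by split_ifs <;> norm_num

/-- Left multiplication by the generator `e i`, in coordinates. -/
lemma mul_e_apply_lowerSign (i : Fin n) (a : Cl n) (C : Finset (Fin n)) :
    mul (e i) a C = (if i ∈ C then 1 else -1) * lowerSign i C * a ({i} ∆ C) := by
  rw [mul_e_apply, mulSign_singleton, lowerSign_symmDiff]
  simp [mem_singleton_symmDiff]

/-- The Clifford relations. -/
lemma mul_e_mul_e_add (i j : Fin n) (a : Cl n) :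
    mul (e i) (mul (e j) a) + mul (e j) (mul (e i) a) = if i = j then (-2 : ℝ) • a else 0 := by
  funext C
  simp only [add_apply', mul_e_apply_lowerSign, lowerSign_symmDiff]
  by_cases h : i = j
  · subst h
    have := lowerSign_mul_self i C
    simp only [if_true, smul_apply', symmDiff_symmDiff_cancel_left, mem_singleton_symmDiff]
    by_cases hi : i ∈ C <;> simp [hi] <;> linear_combination (-2 * a C) * this
  · have hc : {j} ∆ ({i} ∆ C) = {i} ∆ ({j} ∆ C) := symmDiff_left_comm _ _ _
    rw [if_neg h, zero_apply', hc]
    simp only [mem_singleton_symmDiff, h, Ne.symm h]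
    rcases lt_or_gt_of_ne h with hl | hl <;> simp [hl, hl.not_gt, h, Ne.symm h] <;> split_ifs <;> ring

/-- Left multiplication by `e i` as a continuous linear map. -/
def mulE (i : Fin n) : Cl n →L[ℝ] Cl n :=
  LinearMap.toContinuousLinearMap
    { toFun := mul (e i)
      map_add' := fun a b => funext fun C => by
        simp only [mul_e_apply, add_apply']; ring
      map_smul' := fun r a => funext fun C => by
        simp only [mul_e_apply, smul_apply', RingHom.id_apply]; ring }

lemma mulE_apply (i : Fin n) (a : Cl n) : mulE i a = mul (e i) a := rfl

/-- The map `a ↦ (Q a)′` as a continuous linear map. -/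
def involuteQ (m : ℕ) : Cl (m + 1) →L[ℝ] Cl (m + 1) :=
  LinearMap.toContinuousLinearMap
    { toFun := fun a => involute (Qpart a)
      map_add' := fun a b => funext fun C => by
        simp only [involute, Qpart, add_apply']; split_ifs <;> ring
      map_smul' := fun r a => funext fun C => by
        simp only [involute, Qpart, smul_apply', RingHom.id_apply]; split_ifs <;> ring }

lemma involuteQ_apply {m : ℕ} (a : Cl (m + 1)) : involuteQ m a = involute (Qpart a) := rfl

lemma involuteQ_coord {m : ℕ} (a : Cl (m + 1)) (C : Finset (Fin (m + 1))) :
    involuteQ m a C =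
      (-1 : ℝ) ^ C.card * if Fin.last m ∈ C then 0 else a (insert (Fin.last m) C) := rfl

lemma involuteQ_involuteQ {m : ℕ} (a : Cl (m + 1)) : involuteQ m (involuteQ m a) = 0 := by
  funext C
  simp [involuteQ_coord, zero_apply']

lemma involuteQ_mulE_involuteQ {m : ℕ} (i : Fin (m + 1)) (a : Cl (m + 1)) :
    involuteQ m (mulE i (involuteQ m a)) = if i = Fin.last m then involuteQ m a else 0 := by
  funext C
  by_cases hC : Fin.last m ∈ C
  · split_ifs <;> simp [involuteQ_coord, hC, zero_apply']
  rw [involuteQ_coord, if_neg hC, mulE_apply, mul_e_apply_lowerSign, involuteQ_coord]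
  by_cases hi : i = Fin.last m
  · subst hi
    rw [← singleton_symmDiff_of_notMem hC, symmDiff_symmDiff_cancel_left, if_pos rfl,
      involuteQ_coord, if_neg hC, lowerSign_symmDiff]
    have h1 : lowerSign (Fin.last m) C = (-1) ^ C.card := by
      unfold lowerSign
      rw [Finset.prod_congr rfl (g := fun _ => (-1 : ℝ)), Finset.prod_const]
      intro j hj
      rw [if_pos (Fin.lt_last_iff_ne_last.2 fun h => hC (h ▸ hj))]
    have h2 : ((-1 : ℝ) ^ C.card) * (-1) ^ C.card = 1 := by
      rw [← mul_pow]; simp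
    rw [h1, if_pos (mem_singleton_symmDiff.2 (Or.inl ⟨rfl, hC⟩)), if_neg (lt_irrefl _)]
    linear_combination ((-1 : ℝ) ^ C.card * a (insert (Fin.last m) C)) * h2
  · have hmem : Fin.last m ∈ {i} ∆ insert (Fin.last m) C :=
      mem_singleton_symmDiff.2 (Or.inr ⟨Ne.symm hi, Finset.mem_insert_self _ _⟩)
    rw [if_neg hi, if_pos hmem, zero_apply', mul_zero, mul_zero, mul_zero]

/-- The coefficients of the Dirac operator. -/
def diracCoeff (n : ℕ) : Fin (n + 1) → Cl n →L[ℝ] Cl n :=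
  Fin.cons (ContinuousLinearMap.id ℝ (Cl n)) mulE

/-- The coefficients of the conjugate Dirac operator. -/
def diracBarCoeff (n : ℕ) : Fin (n + 1) → Cl n →L[ℝ] Cl n :=
  Fin.cons (ContinuousLinearMap.id ℝ (Cl n)) (fun i => -mulE i)

lemma dirac_eq_sum (f : (Fin (n + 1) → ℝ) → Cl n) :
    dirac f = fun x => ∑ i, diracCoeff n i (pderiv i f x) := by
  funext x
  rw [Fin.sum_univ_succ]
  rfl

lemma diracBarCoeff_diracCoeff (i j : Fin (n + 1)) (a : Cl n) :
    diracBarCoeff n i (diracCoeff n j a) + diracBarCoeff n j (diracCoeff n i a) =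
      if i = j then (2 : ℝ) • a else 0 := by
  induction i using Fin.cases with
  | zero =>
    induction j using Fin.cases with
    | zero => simp [diracBarCoeff, diracCoeff, two_smul]
    | succ j => simp [diracBarCoeff, diracCoeff, (Fin.succ_ne_zero j).symm]
  | succ i =>
    induction j using Fin.cases with
    | zero => simp [diracBarCoeff, diracCoeff]
    | succ j =>
      have h := mul_e_mul_e_add i j a
      simp only [diracBarCoeff, diracCoeff, Fin.cons_succ, neg_apply,
        mulE_apply, Fin.succ_inj, ← neg_add, h]
      split_ifs <;> simp

lemma involuteQ_diracBarCoeff_involuteQ {m : ℕ} (i : Fin (m + 2)) (a : Cl (m + 1)) :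
    involuteQ m (diracBarCoeff (m + 1) i (involuteQ m a)) =
      if i = Fin.last (m + 1) then -involuteQ m a else 0 := by
  induction i using Fin.cases with
  | zero =>
    have : (0 : Fin (m + 2)) ≠ Fin.last (m + 1) := (Fin.last_pos).ne
    simp [diracBarCoeff, involuteQ_involuteQ, this]
  | succ i =>
    simp only [diracBarCoeff, Fin.cons_succ, neg_apply, map_neg,
      involuteQ_mulE_involuteQ, ← Fin.succ_last, Fin.succ_inj]
    split_ifs <;> simp

end Algebra

lemma isOpen_upperHalf (n : ℕ) : IsOpen (upperHalf n) :=
  isOpen_lt continuous_const (continuous_apply _)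

end Cl

/-- If `f` is `k`-hypermonogenic for a positive even `k`, then `Δf` is
`(k-2)`-hypermonogenic.  Here `n = m + 1 ≥ 1`. -/
theorem laplacian_of_k_hypermonogenic
    (m : ℕ) (k : ℕ) (hk : Even k) (hkpos : 0 < k)
    (f : (Fin (m + 2) → ℝ) → Cl (m + 1))
    (hf : ContDiffOn ℝ (⊤ : ℕ∞) f (Cl.upperHalf (m + 1)))
    (hmono : ∀ x ∈ Cl.upperHalf (m + 1),
      Cl.dirac f x + ((k : ℝ) / x (Fin.last (m + 1))) •
        Cl.involute (Cl.Qpart (f x)) = 0) :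
    ∀ x ∈ Cl.upperHalf (m + 1),
      Cl.dirac (Cl.lap f) x + (((k : ℝ) - 2) / x (Fin.last (m + 1))) •
        Cl.involute (Cl.Qpart (Cl.lap f x)) = 0 := by
  intro x hx
  set l := Fin.last (m + 1) with hl
  set T := Cl.involuteQ m
  have hU := Cl.isOpen_upperHalf (m + 1)
  have hxl : x l ≠ 0 := ne_of_gt hx
  have hD : ContDiffOn ℝ (⊤ : ℕ∞) (Cl.dirac f) (Cl.upperHalf (m + 1)) := by
    rw [Cl.dirac_eq_sum]
    exact ContDiffOn.sum fun i _ => Cl.smoothOn_clm _ (Cl.smoothOn_pderiv hU hf i)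
  have hdD := Cl.differentiableAt_of_smoothOn hU hD hx
  have hdf := Cl.differentiableAt_of_smoothOn hU hf hx
  have heq : Set.EqOn (fun y => y l • Cl.dirac f y) (fun y => (-(k : ℝ) • T) (f y))
      (Cl.upperHalf (m + 1)) := fun y hy => by
    have h := hmono y hy
    rw [← Cl.involuteQ_apply] at h
    have hyl : y l ≠ 0 := ne_of_gt hy
    simp only [eq_neg_of_add_eq_zero_left h, smul_neg, smul_smul, mul_div_cancel₀ _ hyl,
      neg_smul]
    rfl
  have hpd (i : Fin (m + 2)) : (if i = l then Cl.dirac f x else 0) +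
      x l • Cl.pderiv i (Cl.dirac f) x = -(k : ℝ) • T (Cl.pderiv i f x) := by
    rw [← Cl.pderiv_coord_smul l hdD, Cl.pderiv_congr hU heq i hx, Cl.pderiv_clm _ hdf]
    rfl
  have hlapD : Cl.lap (Cl.dirac f) x = Cl.dirac (Cl.lap f) x := by
    rw [Cl.dirac_eq_sum f, Cl.dirac_eq_sum (Cl.lap f)]
    exact Cl.lap_sum_clm_pderiv _ hU hf hx
  have hlap : x l • Cl.dirac (Cl.lap f) x + (2 : ℝ) • Cl.pderiv l (Cl.dirac f) x =
      -(k : ℝ) • T (Cl.lap f x) := by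
    rw [← hlapD, ← Cl.lap_coord_smul l hU hD hx, Cl.lap_congr hU heq hx, Cl.lap_clm _ hU hf hx]
    rfl
  have hbar : ∑ i, Cl.diracBarCoeff (m + 1) i (Cl.pderiv i (Cl.dirac f) x) = Cl.lap f x := by
    rw [Cl.dirac_eq_sum f]
    exact Cl.sum_clm_pderiv_sum_clm_pderiv _ _ Cl.diracBarCoeff_diracCoeff hU hf hx
  have hTT (i : Fin (m + 2)) (a : Cl (m + 1)) :
      T (Cl.diracBarCoeff (m + 1) i (T a)) = if i = l then -T a else 0 :=
    Cl.involuteQ_diracBarCoeff_involuteQ i a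
  have hTbar : T (Cl.diracBarCoeff (m + 1) l (Cl.dirac f x)) = -Cl.dirac f x := by
    refine smul_right_injective _ hxl ?_
    have h := heq hx
    simp only [smul_apply] at h
    simp only [← map_smul, smul_neg, h]
    rw [map_smul, map_smul, map_smul, hTT, if_pos rfl, smul_neg]
  have hQ : T (Cl.lap f x) = -Cl.pderiv l (Cl.dirac f) x := by
    refine smul_right_injective _ hxl ?_
    have h : ∑ i, T (Cl.diracBarCoeff (m + 1) i ((if i = l then Cl.dirac f x else 0) +
        x l • Cl.pderiv i (Cl.dirac f) x)) =
        ∑ i, T (Cl.diracBarCoeff (m + 1) i (-(k : ℝ) • T (Cl.pderiv i f x))) := by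
      simp only [hpd]
    have h1 (i : Fin (m + 2)) : T (Cl.diracBarCoeff (m + 1) i (if i = l then Cl.dirac f x else 0))
        = if i = l then -Cl.dirac f x else 0 := by
      split_ifs with hi
      · rw [hi, hTbar]
      · simp
    simp only [map_add, map_smul, Finset.sum_add_distrib, h1, ← Finset.smul_sum, ← map_sum, hbar,
      Finset.sum_ite_eq', Finset.mem_univ, if_true, hTT] at h
    have h2 := hpd l
    rw [if_pos rfl] at h2
    change _ • _ = _ • _
    linear_combination (norm := module) h + h2
  rw [← Cl.involuteQ_apply]
  refine smul_right_injective _ hxl ?_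
  simp only [smul_add, smul_smul, mul_div_cancel₀ _ hxl, smul_zero]
  change _ + _ • T _ = 0
  rw [eq_sub_of_add_eq hlap, hQ]
  module
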